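/- There is no metric d on ℝ such that for all subsets A and B of ℝ, the Hausdorff distance d_H(A,B) is finite if and only if there exists r > 0 with A ⊆ ⋃_{b∈B} (b−r, +∞) and B ⊆ ⋃_{a∈A} (a−r, +∞). -/

import Mathlib

theorem hausdorffEDist_singleton_ne_top {X : Type*} [PseudoMetricSpace X] {s : Set X} {o : X}
    {M : ℝ} (hs : s.Nonempty) (h : ∀ x ∈ s, dist o x ≤ M) :
    Metric.hausdorffEDist s {o} ≠ ⊤ := by
  refine Metric.hausdorffEDist_ne_top_of_nonempty_of_bounded hs (Set.singleton_nonempty o) ?_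
    Bornology.isBounded_singleton
  exact Metric.isBounded_closedBall.subset
    (fun x hx => Metric.mem_closedBall'.2 (h x hx) : s ⊆ Metric.closedBall o M)

/-- If the distances of the terms of a sequence to a base point have gaps growing to infinity,
then the terms of even index and the terms of odd index are at infinite Hausdorff distance. -/
theorem hausdorffEDist_even_odd_eq_top {X : Type*} [PseudoMetricSpace X] {o : X} {x : ℕ → X}
    (h : ∀ n : ℕ, dist o (x n) + n + 1 < dist o (x (n + 1))) :
    Metric.hausdorffEDist (Set.range fun k => x (2 * k)) (Set.range fun k => x (2 * k + 1)) = ⊤ := by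
  have hmono : Monotone fun n => dist o (x n) :=
    monotone_nat_of_le_succ fun n => by
      have := h n
      have : (0 : ℝ) ≤ n := n.cast_nonneg
      linarith
  by_contra hfin
  rw [Metric.hausdorffEDist_comm] at hfin
  obtain ⟨k, hk⟩ := exists_nat_gt
    (Metric.hausdorffEDist (Set.range fun k => x (2 * k + 1)) (Set.range fun k => x (2 * k))).toReal
  have hlt : Metric.hausdorffEDist (Set.range fun k => x (2 * k + 1))
      (Set.range fun k => x (2 * k)) < ENNReal.ofReal k :=
    (ENNReal.lt_ofReal_iff_toReal_lt hfin).2 hk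
  obtain ⟨_, ⟨j, rfl⟩, hj⟩ := Metric.exists_edist_lt_of_hausdorffEDist_lt (Set.mem_range_self k) hlt
  replace hj : dist (x (2 * k + 1)) (x (2 * j)) < k := edist_lt_ofReal.1 hj
  have h₁ := dist_triangle o (x (2 * k + 1)) (x (2 * j))
  have h₂ := dist_triangle_right o (x (2 * k + 1)) (x (2 * j))
  have hk₀ : (0 : ℝ) ≤ k := k.cast_nonneg
  rcases le_or_gt j k with hjk | hjk
  · have h₃ : dist o (x (2 * j)) ≤ dist o (x (2 * k)) := hmono (by lia)
    have h₄ := h (2 * k)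
    push_cast at h₄
    linarith
  · have h₃ : dist o (x (2 * k + 1 + 1)) ≤ dist o (x (2 * j)) := hmono (by lia)
    have h₄ := h (2 * k + 1)
    push_cast at h₄
    linarith

theorem subset_iUnion_Ioi_of_not_bddBelow {A B : Set ℝ} (hB : ¬ BddBelow B) (r : ℝ) :
    A ⊆ ⋃ b ∈ B, Set.Ioi (b - r) := by
  intro a _
  obtain ⟨b, hb, hba⟩ := not_bddBelow_iff.1 hB (a + r)
  exact Set.mem_biUnion hb (Set.mem_Ioi.2 (by linarith))

theorem not_bddBelow_range_comp_of_lt_neg {x : ℕ → ℝ} (hx : ∀ n : ℕ, x n < -n) {φ : ℕ → ℕ}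
    (hφ : ∀ k, k ≤ φ k) : ¬ BddBelow (Set.range fun k => x (φ k)) := by
  refine not_bddBelow_iff.2 fun c => ?_
  obtain ⟨n, hn⟩ := exists_nat_gt (-c)
  have hle : (n : ℝ) ≤ φ n := Nat.cast_le.2 (hφ n)
  exact ⟨x (φ n), ⟨n, rfl⟩, by linarith [hx (φ n)]⟩

/-- There is no metric on `ℝ` such that, for all subsets `A`, `B` of `ℝ`, the Hausdorff
distance `d_H(A,B)` is finite iff there exists `r > 0` with `A ⊆ ⋃_{b ∈ B} (b - r, ∞)`
and `B ⊆ ⋃_{a ∈ A} (a - r, ∞)`. -/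
theorem stmt_19 :
    ¬ ∃ m : MetricSpace ℝ,
      ∀ A B : Set ℝ,
        ((@EMetric.hausdorffEdist ℝ
            (@PseudoMetricSpace.toPseudoEMetricSpace ℝ m.toPseudoMetricSpace) A B) ≠ ⊤ ↔
          ∃ r > (0 : ℝ), A ⊆ (⋃ b ∈ B, Set.Ioi (b - r)) ∧ B ⊆ ⋃ a ∈ A, Set.Ioi (a - r)) := by
  rintro ⟨m, hm⟩
  let d : ℝ → ℝ := @dist ℝ m.toDist 0
  have exists_far (M c : ℝ) : ∃ x < c, M < d x := by
    by_contra! hcon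
    obtain ⟨r, -, hr, -⟩ := (hm (Set.Iio c) {0}).1
      (@hausdorffEDist_singleton_ne_top ℝ m.toPseudoMetricSpace _ _ M Set.nonempty_Iio hcon)
    have hmem : min (c - 1) (-r) ∈ Set.Iio c := (min_le_left _ _).trans_lt (sub_one_lt c)
    have := hr hmem
    simp at this
  choose g hg_lt hg_far using exists_far
  let x : ℕ → ℝ := fun n => Nat.rec (g 0 0) (fun n y => g (d y + n + 1) (-(n + 1 : ℕ))) n
  have hx_lt (n : ℕ) : x n < -n := by
    cases n with
    | zero => exact (hg_lt 0 0).trans_eq (by simp)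
    | succ n => exact hg_lt _ _
  have hx_far (n : ℕ) : d (x n) + n + 1 < d (x (n + 1)) := hg_far _ _
  have heven : ¬ BddBelow (Set.range fun k => x (2 * k)) :=
    not_bddBelow_range_comp_of_lt_neg (φ := fun k => 2 * k) hx_lt fun k => by lia
  have hodd : ¬ BddBelow (Set.range fun k => x (2 * k + 1)) :=
    not_bddBelow_range_comp_of_lt_neg (φ := fun k => 2 * k + 1) hx_lt fun k => by lia
  exact (hm _ _).2 ⟨1, one_pos, subset_iUnion_Ioi_of_not_bddBelow hodd 1,
    subset_iUnion_Ioi_of_not_bddBelow heven 1⟩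
    (@hausdorffEDist_even_odd_eq_top ℝ m.toPseudoMetricSpace 0 x hx_far)
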